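/- Let S be a simple-minded collection of a triangulated category T. Then the pair (T^{S,≤0}, T^{S,≥0}) is a t-structure on T whose heart is the extension closure Filt(S), and moreover T^{S,≤0} is the union over l ≥ 0 of Σ^l Filt(S) ∗ Σ^{l-1} Filt(S) ∗ ⋯ ∗ Σ Filt(S) ∗ Filt(S). -/

import Mathlib

open CategoryTheory Limits Pretriangulated

namespace STPaper

variable {T : Type*} [Category T] [Preadditive T] [HasZeroObject T]
  [HasShift T ℤ] [∀ n : ℤ, (CategoryTheory.shiftFunctor T n).Additive] [Pretriangulated T]

/-- The shift of a class of objects. -/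
def shSet (S : Set T) (n : ℤ) : Set T := (CategoryTheory.shiftFunctor T n).obj '' S

/-- The class `Y₁ ∗ Y₂`: objects `Z` fitting in a distinguished triangle
`Y₁ → Z → Y₂ → ΣY₁` with `Y₁ ∈ 𝒴₁` and `Y₂ ∈ 𝒴₂`. -/
def star (Y₁ Y₂ : Set T) : Set T :=
  {Z | ∃ (A B : T) (f : A ⟶ Z) (g : Z ⟶ B) (h : B ⟶ A⟦(1:ℤ)⟧),
    (Triangle.mk f g h ∈ distTriang T) ∧ A ∈ Y₁ ∧ B ∈ Y₂}

/-- The extension closure of a class of objects. -/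
inductive filt (S : Set T) : T → Prop
  | of {X : T} (h : X ∈ S) : filt S X
  | zero {X : T} (h : IsZero X) : filt S X
  | ext {A Z B : T} (f : A ⟶ Z) (g : Z ⟶ B) (h : B ⟶ A⟦(1:ℤ)⟧)
      (hT : Triangle.mk f g h ∈ distTriang T) (hA : filt S A) (hB : filt S B) : filt S Z

/-- The thick subcategory generated by a class of objects. -/
inductive thick (S : Set T) : T → Prop
  | of {X : T} (h : X ∈ S) : thick S X
  | zero {X : T} (h : IsZero X) : thick S X
  | shift {X : T} (hX : thick S X) (n : ℤ) : thick S (X⟦n⟧)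
  | ext {A Z B : T} (f : A ⟶ Z) (g : Z ⟶ B) (h : B ⟶ A⟦(1:ℤ)⟧)
      (hT : Triangle.mk f g h ∈ distTriang T) (hA : thick S A) (hB : thick S B) : thick S Z
  | smd {X Y : T} (i : X ⟶ Y) (r : Y ⟶ X) (hir : i ≫ r = 𝟙 X) (hY : thick S Y) : thick S X

/-- Two classes of objects coincide up to isomorphism. -/
def isoEq (S L : Set T) : Prop :=
  (∀ X ∈ S, ∃ Y ∈ L, Nonempty (X ≅ Y)) ∧ (∀ Y ∈ L, ∃ X ∈ S, Nonempty (X ≅ Y))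

/-- A simple-minded collection. -/
structure IsSMC (S : Set T) : Prop where
  negVanish : ∀ X ∈ S, ∀ Y ∈ S, ∀ n : ℤ, n < 0 → ∀ f : X ⟶ Y⟦n⟧, f = 0
  nonzero : ∀ X ∈ S, ¬ IsZero X
  endo : ∀ X ∈ S, ∀ f : X ⟶ X, f = 0 ∨ IsIso f
  noHom : ∀ X ∈ S, ∀ Y ∈ S, X ≠ Y → ∀ f : X ⟶ Y, f = 0
  generates : ∀ X : T, thick S X

/-- `T^{𝒮,≤0}` for a collection `S`. -/
def leS (S : Set T) : Set T :=
  {X | ∀ n : ℤ, 0 < n → ∀ Y ∈ S, ∀ f : X⟦n⟧ ⟶ Y, f = 0}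

/-- `Σ^{0}Filt(S) ∗ Σ^{-1}Filt(S) ∗ ⋯ ∗ Σ^{-l}Filt(S)`. -/
def geChainS (S : Set T) : ℕ → Set T
  | 0 => {X | filt S X}
  | (l+1) => star (geChainS S l) (shSet {X | filt S X} (-(l+1 : ℤ)))

/-- `T^{𝒮,≥0}`. -/
def geS (S : Set T) : Set T := ⋃ l, geChainS S l

/-- `Σ^{l}Filt(S) ∗ Σ^{l-1}Filt(S) ∗ ⋯ ∗ Filt(S)`. -/
def leChainS (S : Set T) : ℕ → Set T
  | 0 => {X | filt S X}
  | (l+1) => star (shSet {X | filt S X} (l+1 : ℤ)) (leChainS S l)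

/-- A `t`-structure `(Le, Ge) = (T^{≤0}, T^{≥0})` on `T`. -/
structure IsTStr (Le Ge : Set T) : Prop where
  le_shift : ∀ X ∈ Le, X⟦(1:ℤ)⟧ ∈ Le
  ge_shift : ∀ X ∈ Ge, X⟦(-1:ℤ)⟧ ∈ Ge
  hom_zero : ∀ X ∈ Le, ∀ Y ∈ Ge, ∀ f : X ⟶ Y⟦(-1:ℤ)⟧, f = 0
  exhaust : ∀ Z : T, Z ∈ star Le (shSet Ge (-1))

/-- The heart of a pair of classes. -/
def heart (Le Ge : Set T) : Set T := Le ∩ Ge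

/-- A bounded `t`-structure. -/
structure IsBoundedTStr (Le Ge : Set T) : Prop where
  toIsTStr : IsTStr Le Ge
  bddRight : ∀ X : T, ∃ n : ℤ, X⟦n⟧ ∈ Le
  bddLeft : ∀ X : T, ∃ n : ℤ, X⟦n⟧ ∈ Ge

/-- A simple object of the heart `H`: a nonzero object such that in any distinguished
triangle `A → X → B → ΣA` with `A, B ∈ H`, one of `A`, `B` vanishes. -/
def heartSimple (H : Set T) (X : T) : Prop :=
  X ∈ H ∧ ¬ IsZero X ∧ ∀ (A B : T) (f : A ⟶ X) (g : X ⟶ B) (h : B ⟶ A⟦(1:ℤ)⟧),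
    (Triangle.mk f g h ∈ distTriang T) → A ∈ H → B ∈ H → IsZero A ∨ IsZero B

/-- An algebraic `t`-structure: a bounded `t`-structure whose heart is a length category,
i.e. every object of the heart is a finite iterated extension of simple objects of the heart. -/
def IsAlgTStr (Le Ge : Set T) : Prop :=
  IsBoundedTStr Le Ge ∧ ∀ X ∈ heart Le Ge, filt {Y | heartSimple (heart Le Ge) Y} X


set_option linter.unusedSectionVars false
set_option linter.unusedVariables false

/-- shorthand -/
abbrev DT {A B C : T} (f : A ⟶ B) (g : B ⟶ C) (h : C ⟶ A⟦(1:ℤ)⟧) : Prop :=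
  Triangle.mk f g h ∈ distTriang T

lemma DT.rot {A B C : T} {f : A ⟶ B} {g : B ⟶ C} {h : C ⟶ A⟦(1:ℤ)⟧} (H : DT f g h) :
    DT g h (-f⟦(1:ℤ)⟧') := rot_of_distTriang _ H

lemma DT.z12 {A B C : T} {f : A ⟶ B} {g : B ⟶ C} {h : C ⟶ A⟦(1:ℤ)⟧} (H : DT f g h) :
    f ≫ g = 0 := comp_distTriang_mor_zero₁₂ _ H

lemma DT.z23 {A B C : T} {f : A ⟶ B} {g : B ⟶ C} {h : C ⟶ A⟦(1:ℤ)⟧} (H : DT f g h) :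
    g ≫ h = 0 := comp_distTriang_mor_zero₂₃ _ H

lemma DT.z31 {A B C : T} {f : A ⟶ B} {g : B ⟶ C} {h : C ⟶ A⟦(1:ℤ)⟧} (H : DT f g h) :
    h ≫ f⟦(1:ℤ)⟧' = 0 := comp_distTriang_mor_zero₃₁ _ H

lemma DT.co1 {A B C : T} {f : A ⟶ B} {g : B ⟶ C} {h : C ⟶ A⟦(1:ℤ)⟧} (H : DT f g h)
    {U : T} (t : U ⟶ A⟦(1:ℤ)⟧) (ht : t ≫ f⟦(1:ℤ)⟧' = 0) : ∃ s : U ⟶ C, s ≫ h = t := by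
  obtain ⟨s, hs⟩ := Triangle.coyoneda_exact₁ _ H t ht
  exact ⟨s, hs.symm⟩

lemma DT.co2 {A B C : T} {f : A ⟶ B} {g : B ⟶ C} {h : C ⟶ A⟦(1:ℤ)⟧} (H : DT f g h)
    {U : T} (t : U ⟶ B) (ht : t ≫ g = 0) : ∃ s : U ⟶ A, s ≫ f = t := by
  obtain ⟨s, hs⟩ := Triangle.coyoneda_exact₂ _ H t ht
  exact ⟨s, hs.symm⟩

lemma DT.co3 {A B C : T} {f : A ⟶ B} {g : B ⟶ C} {h : C ⟶ A⟦(1:ℤ)⟧} (H : DT f g h)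
    {U : T} (t : U ⟶ C) (ht : t ≫ h = 0) : ∃ s : U ⟶ B, s ≫ g = t := by
  obtain ⟨s, hs⟩ := Triangle.coyoneda_exact₃ _ H t ht
  exact ⟨s, hs.symm⟩

lemma DT.yo2 {A B C : T} {f : A ⟶ B} {g : B ⟶ C} {h : C ⟶ A⟦(1:ℤ)⟧} (H : DT f g h)
    {U : T} (t : B ⟶ U) (ht : f ≫ t = 0) : ∃ s : C ⟶ U, g ≫ s = t := by
  obtain ⟨s, hs⟩ := Triangle.yoneda_exact₂ _ H t ht
  exact ⟨s, hs.symm⟩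

lemma DT.yo3 {A B C : T} {f : A ⟶ B} {g : B ⟶ C} {h : C ⟶ A⟦(1:ℤ)⟧} (H : DT f g h)
    {U : T} (t : C ⟶ U) (ht : g ≫ t = 0) : ∃ s : A⟦(1:ℤ)⟧ ⟶ U, h ≫ s = t := by
  obtain ⟨s, hs⟩ := Triangle.yoneda_exact₃ _ H t ht
  exact ⟨s, hs.symm⟩

lemma DT.yo1 {A B C : T} {f : A ⟶ B} {g : B ⟶ C} {h : C ⟶ A⟦(1:ℤ)⟧} (H : DT f g h)
    {W : T} (p : A ⟶ W) (hp : h ≫ p⟦(1:ℤ)⟧' = 0) : ∃ s : B ⟶ W, f ≫ s = p := by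
  obtain ⟨s, hs⟩ := H.rot.yo3 _ hp
  obtain ⟨s', rfl⟩ := (shiftFunctor T (1:ℤ)).map_surjective s
  refine ⟨-s', (shiftFunctor T (1:ℤ)).map_injective ?_⟩
  rw [← hs]; simp

/-- connecting down -/
lemma DT.co0 {A B C : T} {f : A ⟶ B} {g : B ⟶ C} {h : C ⟶ A⟦(1:ℤ)⟧} (H : DT f g h)
    {U : T} (x : U ⟶ A) (hx : x ≫ f = 0) : ∃ s : U⟦(1:ℤ)⟧ ⟶ C, s ≫ h = x⟦(1:ℤ)⟧' :=
  H.co1 _ (by rw [← Functor.map_comp, hx, Functor.map_zero])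

lemma shz {A B : T} {x : A ⟶ B} (h : x⟦(1:ℤ)⟧' = 0) : x = 0 :=
  (shiftFunctor T (1:ℤ)).map_injective (by rw [h, Functor.map_zero])

lemma DT.coinj {A B C : T} {f : A ⟶ B} {g : B ⟶ C} {h : C ⟶ A⟦(1:ℤ)⟧} (H : DT f g h)
    {U : T} (hU : ∀ t : U⟦(1:ℤ)⟧ ⟶ C, t = 0) (x : U ⟶ A) (hx : x ≫ f = 0) : x = 0 := by
  obtain ⟨s, hs⟩ := H.co0 x hx
  exact shz (by rw [← hs, hU s, zero_comp])

lemma cone_ex {A B : T} (f : A ⟶ B) : ∃ (C : T) (g : B ⟶ C) (h : C ⟶ A⟦(1:ℤ)⟧), DT f g h :=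
  distinguished_cocone_triangle f

lemma fib_ex {B C : T} (g : B ⟶ C) : ∃ (A : T) (f : A ⟶ B) (h : C ⟶ A⟦(1:ℤ)⟧), DT f g h :=
  distinguished_cocone_triangle₁ g

lemma mid_ex {A C : T} (h : C ⟶ A⟦(1:ℤ)⟧) : ∃ (B : T) (f : A ⟶ B) (g : B ⟶ C), DT f g h :=
  distinguished_cocone_triangle₂ h

section
variable {A B C A' B' C' : T} {f : A ⟶ B} {g : B ⟶ C} {h : C ⟶ A⟦(1:ℤ)⟧}
  {f' : A' ⟶ B'} {g' : B' ⟶ C'} {h' : C' ⟶ A'⟦(1:ℤ)⟧}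

lemma tr3c (H : DT f g h) (H' : DT f' g' h') (a : A ⟶ A') (b : B ⟶ B') (e : f ≫ b = a ≫ f') :
    ∃ c : C ⟶ C', g ≫ c = b ≫ g' ∧ h ≫ a⟦(1:ℤ)⟧' = c ≫ h' :=
  complete_distinguished_triangle_morphism _ _ H H' a b e

lemma tr3a (H : DT f g h) (H' : DT f' g' h') (b : B ⟶ B') (c : C ⟶ C') (e : g ≫ c = b ≫ g') :
    ∃ a : A ⟶ A', f ≫ b = a ≫ f' ∧ h ≫ a⟦(1:ℤ)⟧' = c ≫ h' :=
  complete_distinguished_triangle_morphism₁ _ _ H H' b c e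

lemma tr3b (H : DT f g h) (H' : DT f' g' h') (a : A ⟶ A') (c : C ⟶ C')
    (e : h ≫ a⟦(1:ℤ)⟧' = c ≫ h') :
    ∃ b : B ⟶ B', f ≫ b = a ≫ f' ∧ g ≫ c = b ≫ g' :=
  complete_distinguished_triangle_morphism₂ _ _ H H' a c e

lemma DT.iso (H : DT f g h) (a : A ≅ A') (b : B ≅ B') (c : C ≅ C')
    (e1 : f ≫ b.hom = a.hom ≫ f') (e2 : g ≫ c.hom = b.hom ≫ g')
    (e3 : h ≫ a.hom⟦(1:ℤ)⟧' = c.hom ≫ h') : DT f' g' h' :=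
  isomorphic_distinguished _ H _ (Triangle.isoMk _ _ a b c e1 e2 e3).symm

lemma DT.zeroL (hA : IsZero A) [IsIso g] : DT f g h :=
  (Triangle.distinguished_iff_of_isZero₁ _ hA).2 ‹_›

lemma DT.zeroR (hC : IsZero C) [IsIso f] : DT f g h :=
  (Triangle.distinguished_iff_of_isZero₃ _ hC).2 ‹_›

lemma DT.isoR (H : DT f g h) (hA : IsZero A) : IsIso g :=
  (Triangle.distinguished_iff_of_isZero₁ _ hA).1 H

lemma DT.isoL (H : DT f g h) (hC : IsZero C) : IsIso f :=
  (Triangle.distinguished_iff_of_isZero₃ _ hC).1 H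

end

open ZeroObject in
lemma dt_id_l (X : T) : DT (0 : (0 : T) ⟶ X) (𝟙 X) 0 := DT.zeroL (isZero_zero T)
open ZeroObject in
lemma dt_id_r (X : T) : DT (𝟙 X) (0 : X ⟶ (0:T)) 0 := DT.zeroR (isZero_zero T)

lemma isZero_of_id {X : T} (h : 𝟙 X = 0) : IsZero X := (IsZero.iff_id_eq_zero X).2 h

/-- If `f = 0` and `A⟦1⟧ → B` only zero etc. Cone vanishing. -/
lemma shift_isZero {X : T} (h : IsZero (X⟦(1:ℤ)⟧)) : IsZero X :=
  isZero_of_id (shz (by rw [CategoryTheory.Functor.map_id]; exact (IsZero.iff_id_eq_zero _).1 h))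

/-- shift of a triangle with unspecified maps -/
lemma DT.shift {A B C : T} {f : A ⟶ B} {g : B ⟶ C} {h : C ⟶ A⟦(1:ℤ)⟧} (H : DT f g h) (n : ℤ) :
    ∃ h', DT (f⟦n⟧') (g⟦n⟧') h' := by
  have h1 : DT (n.negOnePow • f⟦n⟧') (n.negOnePow • g⟦n⟧')
      (n.negOnePow • (h⟦n⟧' ≫ (shiftFunctorComm T 1 n).hom.app A)) :=
    Triangle.shift_distinguished _ H n
  rcases Int.even_or_odd n with he | ho
  · rw [Int.negOnePow_even n he] at h1
    simp only [one_smul] at h1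
    exact ⟨_, h1⟩
  · rw [Int.negOnePow_odd n ho] at h1
    simp only [Units.neg_smul, one_smul] at h1
    exact ⟨_, h1.iso (Iso.refl _) (-Iso.refl _) (Iso.refl _) (by simp) (by simp)
      (by rw [Iso.refl_hom, Iso.refl_hom, CategoryTheory.Functor.map_id, Category.comp_id, Category.id_comp])⟩

/-- test objects -/
def Tst (S : Set T) (n : ℤ) (Y : T) : Prop := ∃ s ∈ S, ∃ m < n, Nonempty (Y ≅ s⟦m⟧)
def Le (S : Set T) (n : ℤ) (X : T) : Prop := ∀ Y, Tst S n Y → ∀ f : X ⟶ Y, f = 0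
def Gt (S : Set T) (n : ℤ) (X : T) : Prop := ∀ U, Le S n U → ∀ f : U ⟶ X, f = 0

section
variable {S : Set T} {n m : ℤ} {X Y : T}

lemma Tst.mono (h : Tst S n X) (hn : n ≤ m) : Tst S m X := by
  obtain ⟨s, hs, k, hk, e⟩ := h
  exact ⟨s, hs, k, by omega, e⟩

lemma Le.mono (h : Le S n X) (hn : m ≤ n) : Le S m X := fun Y hY f => h Y (hY.mono hn) f
lemma Gt.mono (h : Gt S n X) (hn : n ≤ m) : Gt S m X := fun Y hY f => h Y (hY.mono hn) f

lemma Tst.gt (h : Tst S n X) : Gt S n X := fun U hU f => hU X h f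

lemma Le.z (h : Le S n X) (h' : Gt S n Y) (f : X ⟶ Y) : f = 0 := h' X h f

lemma Le.of_gt (h : ∀ Y, Gt S n Y → ∀ f : X ⟶ Y, f = 0) : Le S n X := fun Y hY f => h Y hY.gt f

lemma Le.iso (h : Le S n X) (e : X ≅ Y) : Le S n Y := fun Z hZ f => by
  rw [← cancel_epi e.hom, h Z hZ (e.hom ≫ f), comp_zero]

lemma Gt.iso (h : Gt S n X) (e : X ≅ Y) : Gt S n Y := fun Z hZ f => by
  rw [← cancel_mono e.inv, h Z hZ (f ≫ e.inv), zero_comp]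

lemma Le.zero (h : IsZero X) : Le S n X := fun _ _ f => h.eq_of_src f 0
lemma Gt.zero (h : IsZero X) : Gt S n X := fun _ _ f => h.eq_of_tgt f 0

lemma Tst.iso (h : Tst S n X) (e : X ≅ Y) : Tst S n Y := by
  obtain ⟨s, hs, k, hk, ⟨e'⟩⟩ := h
  exact ⟨s, hs, k, hk, ⟨e.symm ≪≫ e'⟩⟩

lemma Tst.shift (h : Tst S n X) (a : ℤ) (hm : m = n + a) : Tst S m (X⟦a⟧) := by
  obtain ⟨s, hs, k, hk, ⟨e'⟩⟩ := h
  exact ⟨s, hs, k + a, by omega,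
    ⟨(shiftFunctor T a).mapIso e' ≪≫ (shiftFunctorAdd T k a).symm.app s⟩⟩

lemma Le.shift (h : Le S n X) (a : ℤ) (hm : m = n + a) : Le S m (X⟦a⟧) := fun Y hY f => by
  have h1 : Tst S n (Y⟦-a⟧) := hY.shift (-a) (by omega)
  have h2 := h _ h1 ((shiftShiftNeg X a).inv ≫ f⟦-a⟧')
  rw [Preadditive.IsIso.comp_left_eq_zero] at h2
  exact (shiftFunctor T (-a)).map_injective (by rw [h2, Functor.map_zero])

lemma Gt.shift (h : Gt S n X) (a : ℤ) (hm : m = n + a) : Gt S m (X⟦a⟧) := fun Y hY f => by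
  have h1 : Le S n (Y⟦-a⟧) := hY.shift (-a) (by omega)
  have h2 := h _ h1 (f⟦-a⟧' ≫ (shiftShiftNeg X a).hom)
  rw [Preadditive.IsIso.comp_right_eq_zero] at h2
  exact (shiftFunctor T (-a)).map_injective (by rw [h2, Functor.map_zero])

lemma Le.s1 (h : Le S n X) (hm : m = n + 1) : Le S m (X⟦(1:ℤ)⟧) := h.shift 1 hm
lemma Gt.s1 (h : Gt S n X) (hm : m = n + 1) : Gt S m (X⟦(1:ℤ)⟧) := h.shift 1 hm

/-- unshift -/
lemma Le.unshift (a : ℤ) (h : Le S m (X⟦a⟧)) (hm : m = n + a) : Le S n X :=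
  (h.shift (-a) (by omega)).iso (shiftShiftNeg X a)
lemma Gt.unshift (a : ℤ) (h : Gt S m (X⟦a⟧)) (hm : m = n + a) : Gt S n X :=
  (h.shift (-a) (by omega)).iso (shiftShiftNeg X a)

variable {A B C : T} {f : A ⟶ B} {g : B ⟶ C} {h : C ⟶ A⟦(1:ℤ)⟧}

lemma Le.ext (H : DT f g h) (hA : Le S n A) (hC : Le S n C) : Le S n B := fun Y hY t => by
  obtain ⟨s, rfl⟩ := H.yo2 t (hA Y hY _)
  rw [hC Y hY s, comp_zero]

lemma Gt.ext (H : DT f g h) (hA : Gt S n A) (hC : Gt S n C) : Gt S n B := fun Y hY t => by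
  obtain ⟨s, rfl⟩ := H.co2 t (hC Y hY _)
  rw [hA Y hY s, zero_comp]

/-- cone of Le -/
lemma Le.cone (H : DT f g h) (hA : Le S m A) (hB : Le S n B) (hm : n ≤ m + 1) : Le S n C :=
  Le.ext H.rot hB ((hA.s1 rfl).mono hm)

lemma Gt.fib (H : DT f g h) (hB : Gt S n B) (hC : Gt S m C) (hm : m ≤ n + 1) : Gt S n A := by
  refine Gt.unshift 1 (Gt.ext H.rot.rot (hC.mono (m := n+1) (by omega)) (hB.s1 rfl)) rfl

/-- Under an epi condition, the fibre is Le. -/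
lemma Le.fib (H : DT f g h) (hB : Le S n B) (hepi : ∀ Y, Gt S (n+1) Y → ∀ y : C ⟶ Y, g ≫ y = 0 → y = 0) :
    Le S n A := fun Y hY s => by
  have h1 : h ≫ s⟦(1:ℤ)⟧' = 0 := hepi _ (hY.gt.s1 rfl) _ (by rw [← Category.assoc, H.z23, zero_comp])
  obtain ⟨t, rfl⟩ := H.yo1 s h1
  rw [hB Y hY t, comp_zero]

lemma Gt.cone (H : DT f g h) (hB : Gt S n B) (hmono : ∀ U, Le S (n-1) U → ∀ x : U ⟶ A, x ≫ f = 0 → x = 0) :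
    Gt S n C := fun U hU t => by
  have h0 : (t ≫ h) ≫ f⟦(1:ℤ)⟧' = 0 := by rw [Category.assoc, H.z31, comp_zero]
  have h1 : (t ≫ h)⟦(-1:ℤ)⟧' ≫ (shiftShiftNeg A (1:ℤ)).hom = 0 := by
    refine hmono (U⟦(-1:ℤ)⟧) (hU.shift _ (by omega)) _ ?_
    have := congrArg (fun z => (shiftFunctor T (-1:ℤ)).map z) h0
    simp only [Functor.map_comp, Functor.map_zero] at this
    have nat := (shiftFunctorCompIsoId T (1:ℤ) (-1) (by simp)).hom.naturality f
    simp only [Functor.id_map, Functor.comp_map] at nat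
    rw [Category.assoc]
    change _ ≫ (shiftFunctorCompIsoId T (1:ℤ) (-1) (by simp)).hom.app A ≫ f = 0
    rw [← nat, ← Category.assoc, Functor.map_comp, this, zero_comp]
  rw [Preadditive.IsIso.comp_right_eq_zero] at h1
  have h2 : t ≫ h = 0 := (shiftFunctor T (-1:ℤ)).map_injective (by rw [h1, Functor.map_zero])
  obtain ⟨s, rfl⟩ := H.co3 t h2
  rw [hB U hU s, zero_comp]

end

lemma fib_uniq {A A' B C : T} {f : A ⟶ B} {f' : A' ⟶ B} {g : B ⟶ C} {h : C ⟶ A⟦(1:ℤ)⟧}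
    {h' : C ⟶ A'⟦(1:ℤ)⟧} (H : DT f g h) (H' : DT f' g h') :
    ∃ α : A ≅ A', α.hom ≫ f' = f := by
  obtain ⟨α, hα1, hα2⟩ := tr3a H H' (𝟙 _) (𝟙 _) (by rw [Category.comp_id, Category.id_comp])
  have : IsIso α := isIso₁_of_isIso₂₃ (Triangle.homMk (Triangle.mk f g h) (Triangle.mk f' g h')
    α (𝟙 B) (𝟙 C) hα1 (show g ≫ 𝟙 C = 𝟙 B ≫ g by rw [Category.comp_id, Category.id_comp]) hα2)
    H H' (show IsIso (𝟙 B) by infer_instance) (show IsIso (𝟙 C) by infer_instance)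
  exact ⟨asIso α, by simpa using hα1.symm⟩

section
variable {S : Set T}
open ZeroObject

lemma filt.iso {X Y : T} (h : filt S X) (e : X ≅ Y) : filt S Y :=
  filt.ext e.hom (0 : Y ⟶ (0 : T)) 0 (DT.zeroR (isZero_zero T)) h (filt.zero (isZero_zero T))

lemma mem_le (hS : IsSMC S) {s : T} (hs : s ∈ S) : Le S 0 s := by
  rintro Y ⟨t, ht, m, hm, ⟨e⟩⟩ f
  have := hS.negVanish s hs t ht m hm (f ≫ e.hom)
  rwa [Preadditive.IsIso.comp_right_eq_zero] at this

lemma mem_gt {s : T} (hs : s ∈ S) : Gt S 1 s :=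
  Tst.gt ⟨s, hs, 0, by omega, ⟨((shiftFunctorZero T ℤ).app s).symm⟩⟩

lemma filt.le (hS : IsSMC S) {X : T} (h : filt S X) : Le S 0 X := by
  induction h with
  | of h => exact mem_le hS h
  | zero h => exact Le.zero h
  | ext f g h hT _ _ hA hB => exact Le.ext hT hA hB

lemma filt.gt {X : T} (h : filt S X) : Gt S 1 X := by
  induction h with
  | of h => exact mem_gt h
  | zero h => exact Gt.zero h
  | ext f g h hT _ _ hA hB => exact Gt.ext hT hA hB

lemma O1 {X Y Z P Q D : T} {f : X ⟶ Y} {f' : Y ⟶ P} {f'' : P ⟶ X⟦(1:ℤ)⟧}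
    {g : Y ⟶ Z} {g' : Z ⟶ Q} {g'' : Q ⟶ Y⟦(1:ℤ)⟧} {k : Z ⟶ D} {k'' : D ⟶ X⟦(1:ℤ)⟧}
    (Hf : DT f f' f'') (Hg : DT g g' g'') (Hk : DT (f ≫ g) k k'')
    (hX : Le S 0 X) (hY : Le S 0 Y) (hZ : Gt S 1 Z) (hP : Gt S 1 P) (hQ : Gt S 1 Q) :
    Gt S 1 D ∧ ∃ (u : P ⟶ D) (v : D ⟶ Q), DT u v (g'' ≫ f'⟦(1:ℤ)⟧') ∧ f' ≫ u = g ≫ k ∧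
      k ≫ v = g' := by
  have hX1 : Le S 1 (X⟦(1:ℤ)⟧) := hX.s1 (by norm_num)
  have hY1 : Le S 1 (Y⟦(1:ℤ)⟧) := hY.s1 (by norm_num)
  obtain ⟨C, a, b, Hc⟩ := mid_ex (g'' ≫ f'⟦(1:ℤ)⟧')
  obtain ⟨z, hz1, hz2⟩ := tr3b Hg Hc f' (𝟙 Q) (by simp)
  rw [Category.comp_id] at hz2
  obtain ⟨d, hd⟩ := Hk.yo2 z (by rw [Category.assoc, hz1, ← Category.assoc, Hf.z12, zero_comp])
  have hC : Gt S 1 C := Gt.ext Hc hP hQ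
  have hD : Gt S 1 D := by
    intro U hU t
    have h1 : (t ≫ k'') ≫ f⟦(1:ℤ)⟧' = 0 := by
      have : ((t ≫ k'') ≫ f⟦(1:ℤ)⟧') ≫ g⟦(1:ℤ)⟧' = 0 := by
        have := Hk.z31
        rw [Functor.map_comp] at this
        simp only [Category.assoc, this, comp_zero]
      obtain ⟨s, hs⟩ := Hg.co1 _ this
      rw [← hs, hU.z hQ s, zero_comp]
    have h2 : t ≫ k'' = 0 := by
      obtain ⟨s, hs⟩ := Hf.co1 _ h1
      rw [← hs, hU.z hP s, zero_comp]
    obtain ⟨s, rfl⟩ := Hk.co3 t h2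
    rw [hU.z hZ s, zero_comp]
  have inj : ∀ {W : T}, Gt S 1 W → ∀ c : C ⟶ W, d ≫ c = 0 → c = 0 := by
    intro W hW c hc
    have h1 : z ≫ c = 0 := by rw [← hd, Category.assoc, hc, comp_zero]
    have h2 : a ≫ c = 0 := by
      obtain ⟨s, hs⟩ := Hf.yo3 (a ≫ c) (by rw [← Category.assoc, ← hz1, Category.assoc, h1, comp_zero])
      rw [← hs, hX1.z hW s, comp_zero]
    obtain ⟨q, rfl⟩ := Hc.yo2 c h2
    obtain ⟨s, hs⟩ := Hg.yo3 q (by rw [hz2, Category.assoc, h1])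
    rw [← hs, hY1.z hW s, comp_zero, comp_zero]
  have surj : ∀ {W : T}, Gt S 1 W → ∀ x : D ⟶ W, ∃ c : C ⟶ W, d ≫ c = x := by
    intro W hW x
    obtain ⟨p, hp⟩ := Hf.yo2 (g ≫ k ≫ x) (by
      rw [← Category.assoc, ← Category.assoc, Hk.z12, zero_comp])
    obtain ⟨s, hs⟩ := Hc.yo1 p (by
      rw [Category.assoc, ← Functor.map_comp, hp, Functor.map_comp, ← Category.assoc, Hg.z31, zero_comp])
    obtain ⟨q, hq⟩ := Hg.yo2 (k ≫ x - z ≫ s) (by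
      rw [Preadditive.comp_sub, ← Category.assoc g z, hz1, Category.assoc, hs, hp, sub_self])
    refine ⟨s + b ≫ q, ?_⟩
    have : k ≫ (x - d ≫ (s + b ≫ q)) = 0 := by
      rw [Preadditive.comp_sub, ← Category.assoc k d, hd, Preadditive.comp_add,
        ← Category.assoc z b, ← hz2, hq]
      abel
    obtain ⟨t, ht⟩ := Hk.yo3 _ this
    rw [hX1.z hW t, comp_zero] at ht
    exact (sub_eq_zero.1 ht.symm).symm
  obtain ⟨e, he⟩ := surj hD (𝟙 D)
  have he' : e ≫ d = 𝟙 C := by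
    refine sub_eq_zero.1 (inj hC _ ?_)
    rw [Preadditive.comp_sub, ← Category.assoc, he]; simp
  let i : C ≅ D := ⟨e, d, he', he⟩
  refine ⟨hD, a ≫ e, d ≫ b, Hc.iso (Iso.refl _) i (Iso.refl _) (by simp [i]) (by simp [i, reassoc_of% he'])
    (by simp), ?_, by rw [← Category.assoc, hd, hz2]⟩
  rw [← Category.assoc, ← hz1, ← hd]
  simp [he]

lemma O2 {X h h1 K1 I : T} {x : X ⟶ h} {f : h ⟶ h1} {w : h1 ⟶ X⟦(1:ℤ)⟧}
    {κ : K1 ⟶ h1} {g : h1 ⟶ I} {r : I ⟶ K1⟦(1:ℤ)⟧}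
    (H1 : DT x f w) (H2 : DT κ g r) (hX : Le S 0 X) (hK : Le S 0 K1) (hh : Le S 0 h)
    (hh' : Gt S 1 h) (hh1 : Gt S 1 h1) (hI : Gt S 1 I) :
    ∃ (k : T) (m : k ⟶ h) (r' : I ⟶ k⟦(1:ℤ)⟧) (p : X ⟶ k) (q : k ⟶ K1) (t : K1 ⟶ X⟦(1:ℤ)⟧),
      DT m (f ≫ g) r' ∧ DT p q t ∧ m ≫ f = q ≫ κ ∧ p ≫ m = x ∧ Le S 0 k ∧ Gt S 1 k := by
  have hX1 : Le S 1 (X⟦(1:ℤ)⟧) := hX.s1 (by norm_num)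
  have hK1 : Le S 1 (K1⟦(1:ℤ)⟧) := hK.s1 (by norm_num)
  obtain ⟨k, m, r', Hm⟩ := fib_ex (f ≫ g)
  have hk : Le S 0 k := Le.fib Hm hh (by
    intro Y hY y hy
    rw [zero_add] at hY
    obtain ⟨s, hs⟩ := H1.yo3 (g ≫ y) (by rw [← Category.assoc, hy])
    rw [hX1.z hY s, comp_zero] at hs
    obtain ⟨s', hs'⟩ := H2.yo3 y hs.symm
    rw [← hs', hK1.z hY s', comp_zero])
  have hk' : Gt S 1 k := Gt.fib Hm hh' hI (by norm_num)
  obtain ⟨p, hp⟩ := Hm.co2 x (by rw [← Category.assoc, H1.z12, zero_comp])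
  obtain ⟨P, p', p'', Hp⟩ := cone_ex p
  have hP : Gt S 1 P := by
    intro U hU t
    obtain ⟨s, hs⟩ := H1.co1 (t ≫ p'') (by
      rw [← hp, Functor.map_comp, Category.assoc, ← Category.assoc p'', Hp.z31, zero_comp, comp_zero])
    rw [hU.z hh1 s, zero_comp] at hs
    obtain ⟨s', rfl⟩ := Hp.co3 t hs.symm
    rw [hU.z hk' s', zero_comp]
  obtain ⟨-, u, v, Huv, e1, e2⟩ := O1 Hp Hm (by rw [hp]; exact H1) hX hk hh' hP hI
  have hv : v = g := by
    obtain ⟨s, hs⟩ := H1.yo3 (v - g) (by rw [Preadditive.comp_sub, e2, sub_self])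
    rw [hX1.z hI s, comp_zero] at hs
    exact sub_eq_zero.1 hs.symm
  subst hv
  obtain ⟨α, hα⟩ := fib_uniq Huv H2
  refine ⟨k, m, r', p, p' ≫ α.hom, α.inv ≫ p'', Hm,
    Hp.iso (Iso.refl _) (Iso.refl _) α (by simp) (by simp) (by simp), ?_, hp, hk, hk'⟩
  rw [← e1, Category.assoc, hα]

/-- split lemmas -/
lemma split1 {A D B c : T} {a : A ⟶ D} {b : D ⟶ B} {w : B ⟶ A⟦(1:ℤ)⟧} {τ : B ⟶ D} {q : D ⟶ c}
    {w' : c ⟶ B⟦(1:ℤ)⟧} (H : DT a b w) (hτ : τ ≫ b = 𝟙 B) (H' : DT τ q w') : IsIso (a ≫ q) := by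
  obtain ⟨ρ, hρ⟩ := H.co2 (𝟙 D - b ≫ τ) (by simp [hτ])
  obtain ⟨e, he⟩ := H'.yo2 ρ (by
    have h1 : (τ ≫ ρ) ≫ a = 0 := by rw [Category.assoc, hρ]; simp [reassoc_of% hτ]
    obtain ⟨s, hs⟩ := H.co0 _ h1
    have : w = 0 := by
      have := H.z23
      rw [← Category.id_comp w, ← hτ, Category.assoc, this, comp_zero]
    exact shz (by rw [← hs, this, comp_zero]))
  have hw : w = 0 := by
    rw [← Category.id_comp w, ← hτ, Category.assoc, H.z23, comp_zero]
  refine ⟨e, ?_, ?_⟩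
  · rw [Category.assoc, he]
    refine sub_eq_zero.1 ?_
    have h1 : (a ≫ ρ - 𝟙 A) ≫ a = 0 := by
      rw [Preadditive.sub_comp, Category.assoc, hρ]; simp [reassoc_of% H.z12]
    obtain ⟨s, hs⟩ := H.co0 _ h1
    exact shz (by rw [← hs, hw, comp_zero])
  · have : q ≫ (e ≫ a ≫ q - 𝟙 c) = 0 := by
      rw [Preadditive.comp_sub, ← Category.assoc q, he, ← Category.assoc ρ, hρ]
      simp [H'.z12]
    obtain ⟨s, hs⟩ := H'.yo3 _ this
    have hw' : w' = 0 := by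
      have := H'.z31
      have h2 := congrArg (fun t => t ≫ b⟦(1:ℤ)⟧') this
      simpa [← Functor.map_comp, hτ] using h2
    rw [hw', zero_comp] at hs
    exact sub_eq_zero.1 hs.symm

lemma split2 {J E K k : T} {a : J ⟶ E} {b : E ⟶ K} {w : K ⟶ J⟦(1:ℤ)⟧} {τ : E ⟶ J} {m : k ⟶ E}
    {w' : J ⟶ k⟦(1:ℤ)⟧} (H : DT a b w) (hτ : a ≫ τ = 𝟙 J) (H' : DT m τ w') : IsIso (m ≫ b) := by
  have hw : w = 0 := by
    have h2 := congrArg (fun t => t ≫ τ⟦(1:ℤ)⟧') H.z31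
    simpa [← Functor.map_comp, hτ] using h2
  have hw' : w' = 0 := by
    rw [← Category.id_comp w', ← hτ, Category.assoc, H'.z23, comp_zero]
  have epi : ∀ {Y : T} (y : K ⟶ Y), b ≫ y = 0 → y = 0 := by
    intro Y y hy
    obtain ⟨s, hs⟩ := H.yo3 y hy
    rw [← hs, hw, zero_comp]
  have mono : ∀ {U : T} (x : U ⟶ k), x ≫ m = 0 → x = 0 := by
    intro U x hx
    obtain ⟨s, hs⟩ := H'.co0 x hx
    exact shz (by rw [← hs, hw', comp_zero])
  obtain ⟨σ, hσ⟩ := H.yo2 (𝟙 E - τ ≫ a) (by simp [reassoc_of% hτ])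
  have hσb : σ ≫ b = 𝟙 K := by
    refine sub_eq_zero.1 (epi _ ?_)
    rw [Preadditive.comp_sub, ← Category.assoc, hσ]; simp [H.z12]
  have hστ : σ ≫ τ = 0 := by
    refine epi _ ?_
    rw [← Category.assoc, hσ]; simp [hτ]
  obtain ⟨e, he⟩ := H'.co2 σ hστ
  refine ⟨e, ?_, by rw [← Category.assoc, he, hσb]⟩
  refine sub_eq_zero.1 (mono _ ?_)
  rw [Preadditive.sub_comp, Category.assoc, Category.assoc, he, hσ]
  simp [reassoc_of% H'.z12]

end

section
variable {S : Set T}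
open ZeroObject

lemma simple_map (hS : IsSMC S) {s t : T} (hs : s ∈ S) (ht : t ∈ S) (φ : s ⟶ t) :
    φ = 0 ∨ IsIso φ := by
  by_cases h : s = t
  · subst h; exact hS.endo s hs φ
  · exact Or.inl (hS.noHom s hs t ht h φ)

lemma nonzero_epi (hS : IsSMC S) {L s : T} (hs : s ∈ S) (hL : Le S 0 L) (g : L ⟶ s) (hg : g ≠ 0)
    (Y : T) (hY : Gt S 1 Y) (y : s ⟶ Y) (hy : g ≫ y = 0) : y = 0 := by
  obtain ⟨C, g', g'', H⟩ := cone_ex g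
  have hC : Le S 1 C := by
    rintro Y ⟨t, ht, m, hm, ⟨e⟩⟩ f
    by_cases hm0 : m < 0
    · exact Le.cone H hL (mem_le hS hs) (by norm_num) Y ⟨t, ht, m, hm0, ⟨e⟩⟩ f
    · obtain rfl : m = 0 := by omega
      let e' : Y ≅ t := e ≪≫ (shiftFunctorZero T ℤ).app t
      have h0 : g' ≫ f ≫ e'.hom = 0 := by
        rcases simple_map hS hs ht (g' ≫ f ≫ e'.hom) with h | h
        · exact h
        · refine absurd ?_ hg
          rw [← cancel_mono (g' ≫ f ≫ e'.hom), ← Category.assoc, H.z12, zero_comp, zero_comp]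
      obtain ⟨r, hr⟩ := H.yo3 _ h0
      rw [(hL.s1 (by norm_num)).z (mem_gt ht) r, comp_zero] at hr
      exact (Preadditive.IsIso.comp_right_eq_zero f e'.hom).1 hr.symm
  obtain ⟨r, rfl⟩ := H.yo2 y hy
  rw [hC.z hY r, comp_zero]

lemma im_filt (hS : IsSMC S) {h : T} (hh : filt S h) : ∀ (L : T), Le S 0 L → ∀ g : L ⟶ h,
    ∃ (i c : T) (ι : i ⟶ h) (π : h ⟶ c) (w : c ⟶ i⟦(1:ℤ)⟧), DT ι π w ∧ filt S i ∧ filt S c ∧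
      ∃ e : L ⟶ i, e ≫ ι = g ∧ ∀ Y, Gt S 1 Y → ∀ y : i ⟶ Y, e ≫ y = 0 → y = 0 := by
  induction hh with
  | @of s hs =>
    intro L hL g
    by_cases hg : g = 0
    · exact ⟨0, s, 0, 𝟙 s, 0, dt_id_l s, .zero (isZero_zero T), .of hs, 0, by simp [hg],
        fun Y hY y _ => (isZero_zero T).eq_of_src _ _⟩
    · exact ⟨s, 0, 𝟙 s, 0, 0, dt_id_r s, .of hs, .zero (isZero_zero T), g, by simp,
        fun Y hY y hy => nonzero_epi hS hs hL g hg Y hY y hy⟩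
  | @zero X hX =>
    intro L hL g
    exact ⟨0, X, 0, 𝟙 X, 0, dt_id_l X, .zero (isZero_zero T), .zero hX, 0, hX.eq_of_tgt _ _,
        fun Y hY y _ => (isZero_zero T).eq_of_src _ _⟩
  | @ext A h B f g w H hA hB ihA ihB =>
    intro L hL l
    have hh : filt S h := .ext f g w H hA hB
    obtain ⟨iB, cB, ιB, πB, wB, HB, fiB, fcB, eB, heB, epiB⟩ := ihB L hL (l ≫ g)
    obtain ⟨h', m, r', p, q, t, Hm, Hp, e1, e2, h'le, h'gt⟩ :=
      O2 H HB (hA.le hS) (fiB.le hS) (hh.le hS) hh.gt hB.gt fcB.gt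
    obtain ⟨l', hl'⟩ := Hm.co2 l (by rw [← Category.assoc, ← heB, Category.assoc, HB.z12, comp_zero])
    have hl'q : l' ≫ q = eB := by
      refine sub_eq_zero.1 (HB.coinj (fun t => (hL.s1 (by norm_num)).z fcB.gt t) _ ?_)
      rw [Preadditive.sub_comp, Category.assoc, ← e1, ← Category.assoc, hl', heB, sub_self]
    obtain ⟨L1, m1, r1, HL⟩ := fib_ex eB
    have hL1 : Le S 0 L1 := Le.fib HL hL (by simpa using epiB)
    obtain ⟨a, ha⟩ := Hp.co2 (m1 ≫ l') (by rw [Category.assoc, hl'q, HL.z12])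
    obtain ⟨iA, cA, ιA, πA, wA, HA, fiA, fcA, eA, heA, epiA⟩ := ihA L1 hL1 a
    obtain ⟨D, k, k'', Hk⟩ := cone_ex (ιA ≫ p)
    obtain ⟨hD, u, v, Huv, -, e3⟩ := O1 HA Hp Hk (fiA.le hS) (hA.le hS) h'gt fcA.gt fiB.gt
    obtain ⟨τ, hτ⟩ := HL.yo2 (l' ≫ k) (by
      rw [← Category.assoc, ← ha, ← heA, Category.assoc, Category.assoc, ← Category.assoc ιA, Hk.z12, comp_zero])
    have hτv : τ ≫ v = 𝟙 iB := by
      refine sub_eq_zero.1 (epiB _ fiB.gt _ ?_)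
      rw [Preadditive.comp_sub, ← Category.assoc, hτ, Category.assoc, e3, hl'q, Category.comp_id, sub_self]
    obtain ⟨c, κ, w', Hc⟩ := cone_ex τ
    have := split1 Huv hτv Hc
    have fc : filt S c := fcA.iso (asIso (u ≫ κ))
    obtain ⟨i, μ, r2, p2, q2, t2, Hμ, Hi, e4, e5, ile, igt⟩ :=
      O2 Hk Hc (fiA.le hS) (fiB.le hS) h'le h'gt hD fc.gt
    have fi : filt S i := .ext _ _ _ Hi fiA fiB
    obtain ⟨e, he⟩ := Hμ.co2 l' (by rw [← Category.assoc, ← hτ, Category.assoc, Hc.z12, comp_zero])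
    obtain ⟨C, k3, k3'', H3⟩ := cone_ex (μ ≫ m)
    obtain ⟨-, u3, v3, Huv3, -, -⟩ := O1 Hμ Hm H3 ile h'le hh.gt fc.gt fcB.gt
    refine ⟨i, C, μ ≫ m, k3, k3'', H3, fi, .ext _ _ _ Huv3 fc fcB, e, by rw [← Category.assoc, he, hl'], ?_⟩
    intro Y hY y hy
    have h1 : eA ≫ p2 = m1 ≫ e := by
      refine sub_eq_zero.1 (Hμ.coinj (fun t => (hL1.s1 (by norm_num)).z fc.gt t) _ ?_)
      rw [Preadditive.sub_comp, Category.assoc, e5, Category.assoc, he, ← Category.assoc, heA, ha, sub_self]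
    have h2 : p2 ≫ y = 0 := epiA Y hY _ (by rw [← Category.assoc, h1, Category.assoc, hy, comp_zero])
    obtain ⟨y', rfl⟩ := Hi.yo2 y h2
    have h3 : e ≫ q2 = eB := by
      have : (e ≫ q2) ≫ τ = eB ≫ τ := by rw [Category.assoc, ← e4, ← Category.assoc, he, hτ]
      have := congrArg (fun t => t ≫ v) this
      simpa only [Category.assoc, hτv, Category.comp_id] using this
    rw [epiB Y hY y' (by rw [← h3, Category.assoc, hy]), comp_zero]

lemma ker_filt (hS : IsSMC S) {b : T} (hb : filt S b) : ∀ (N : T), Gt S 1 N → ∀ g : b ⟶ N,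
    ∃ (k j : T) (ι : k ⟶ b) (π : b ⟶ j) (w : j ⟶ k⟦(1:ℤ)⟧), DT ι π w ∧ filt S k ∧ filt S j ∧
      ∃ γ : j ⟶ N, π ≫ γ = g ∧ ∀ U, Le S 0 U → ∀ x : U ⟶ j, x ≫ γ = 0 → x = 0 := by
  induction hb with
  | @of s hs =>
    intro N hN g
    by_cases hg : g = 0
    · exact ⟨s, 0, 𝟙 s, 0, 0, dt_id_r s, .of hs, .zero (isZero_zero T), 0, by simp [hg],
        fun Y hY y _ => (isZero_zero T).eq_of_tgt _ _⟩
    · refine ⟨0, s, 0, 𝟙 s, 0, dt_id_l s, .zero (isZero_zero T), .of hs, g, by simp,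
        fun U hU x hx => ?_⟩
      by_contra hx0
      exact hg (nonzero_epi hS hs hU x hx0 N hN g hx)
  | @zero X hX =>
    intro N hN g
    exact ⟨X, 0, 𝟙 X, 0, 0, dt_id_r X, .zero hX, .zero (isZero_zero T), 0, hX.eq_of_src _ _,
        fun Y hY y _ => (isZero_zero T).eq_of_tgt _ _⟩
  | @ext A b B f g w H hA hB ihA ihB =>
    intro N hN n
    have hb : filt S b := .ext f g w H hA hB
    obtain ⟨kA, jA, κA, πA, wA, HA, fkA, fjA, γA, hγA, monoA⟩ := ihA N hN (f ≫ n)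
    obtain ⟨b', β, β'', Hb⟩ := cone_ex (κA ≫ f)
    obtain ⟨b'gt, u, v, Huv, e1, e2⟩ := O1 HA H Hb (fkA.le hS) (hA.le hS) hb.gt fjA.gt hB.gt
    have b'le : Le S 0 b' := Le.ext Huv (fjA.le hS) (hB.le hS)
    obtain ⟨n', hn'⟩ := Hb.yo2 n (by rw [Category.assoc, ← hγA, ← Category.assoc, HA.z12, zero_comp])
    have hun : u ≫ n' = γA := by
      obtain ⟨s, hs⟩ := HA.yo3 (u ≫ n' - γA) (by
        rw [Preadditive.comp_sub, ← Category.assoc, e1, Category.assoc, hn', hγA, sub_self])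
      rw [((fkA.le hS).s1 (by norm_num)).z hN s, comp_zero] at hs
      exact sub_eq_zero.1 hs.symm
    obtain ⟨N1, ν, ν', HN⟩ := cone_ex γA
    have hN1 : Gt S 1 N1 := Gt.cone HN hN (by simpa using monoA)
    obtain ⟨φ, hφ⟩ := Huv.yo2 (n' ≫ ν) (by rw [← Category.assoc, hun, HN.z12])
    obtain ⟨kB, jB, κB, πB, wB, HB, fkB, fjB, γB, hγB, monoB⟩ := ihB N1 hN1 φ
    obtain ⟨E, m, r', p, q, t, Hm, Hp, e3, e4, Ele, Egt⟩ :=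
      O2 Huv HB (fjA.le hS) (fkB.le hS) b'le b'gt hB.gt fjB.gt
    obtain ⟨τ, hτ⟩ := HN.co2 (m ≫ n') (by
      rw [Category.assoc, ← hφ, ← Category.assoc, e3, Category.assoc, ← hγB, ← Category.assoc κB, HB.z12,
        zero_comp, comp_zero])
    have hpτ : p ≫ τ = 𝟙 jA := by
      refine sub_eq_zero.1 (monoA _ (fjA.le hS) _ ?_)
      rw [Preadditive.sub_comp, Category.assoc, hτ, ← Category.assoc, e4, hun, Category.id_comp, sub_self]
    obtain ⟨k', μ, w', Hk⟩ := fib_ex τ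
    have := split2 Hp hpτ Hk
    have fk' : filt S k' := fkB.iso (asIso (μ ≫ q)).symm
    obtain ⟨j, θ, θ'', Hj⟩ := cone_ex (μ ≫ m)
    obtain ⟨-, u4, v4, Huv4, e5, e6⟩ := O1 Hk Hm Hj (fk'.le hS) Ele b'gt fjA.gt fjB.gt
    have fj : filt S j := .ext _ _ _ Huv4 fjA fjB
    obtain ⟨k, ι, r5, p5, q5, t5, Hι, Hk5, -, -, -, -⟩ :=
      O2 Hb Hj (fkA.le hS) (fk'.le hS) (hb.le hS) hb.gt b'gt fj.gt
    obtain ⟨γ, hγ⟩ := Hj.yo2 n' (by rw [Category.assoc, ← hτ, ← Category.assoc, Hk.z12, zero_comp])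
    refine ⟨k, j, ι, β ≫ θ, r5, Hι, .ext _ _ _ Hk5 fkA fk', fj, γ, by rw [Category.assoc, hγ, hn'], ?_⟩
    intro U hU x hx
    have h1 : v4 ≫ γB = γ ≫ ν := by
      obtain ⟨s, hs⟩ := Hj.yo3 (v4 ≫ γB - γ ≫ ν) (by
        rw [Preadditive.comp_sub, ← Category.assoc, e6, ← Category.assoc, hγ, Category.assoc, hγB, hφ, sub_self])
      rw [((fk'.le hS).s1 (by norm_num)).z hN1 s, comp_zero] at hs
      exact sub_eq_zero.1 hs.symm
    have h2 : x ≫ v4 = 0 := monoB U hU _ (by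
      rw [Category.assoc, h1, ← Category.assoc, hx, zero_comp])
    obtain ⟨x', rfl⟩ := Huv4.co2 x h2
    have h3 : u4 ≫ γ = γA := by
      have : τ ≫ u4 ≫ γ = τ ≫ γA := by rw [← Category.assoc, e5, Category.assoc, hγ, hτ]
      have := congrArg (fun t => p ≫ t) this
      simpa only [← Category.assoc, hpτ, Category.id_comp] using this
    rw [monoA U hU x' (by rw [← h3, ← Category.assoc, hx]), zero_comp]

end

section
variable {S : Set T}
open ZeroObject

lemma DT.co2s {A B C : T} {f : A ⟶ B} {g : B ⟶ C} {h : C ⟶ A⟦(1:ℤ)⟧} (H : DT f g h)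
    {U : T} (t : U ⟶ B⟦(1:ℤ)⟧) (ht : t ≫ g⟦(1:ℤ)⟧' = 0) : ∃ s : U ⟶ A⟦(1:ℤ)⟧, s ≫ f⟦(1:ℤ)⟧' = t := by
  obtain ⟨s, hs⟩ := H.rot.co1 t ht
  exact ⟨-s, by rw [← hs]; simp⟩

lemma DT.yo2s {A B C : T} {f : A ⟶ B} {g : B ⟶ C} {h : C ⟶ A⟦(1:ℤ)⟧} (H : DT f g h)
    {U : T} (t : B⟦(1:ℤ)⟧ ⟶ U) (ht : f⟦(1:ℤ)⟧' ≫ t = 0) : ∃ s : C⟦(1:ℤ)⟧ ⟶ U, g⟦(1:ℤ)⟧' ≫ s = t := by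
  obtain ⟨s, hs⟩ := H.rot.rot.yo3 t (by rw [Preadditive.neg_comp, ht, neg_zero])
  exact ⟨-s, by rw [← hs]; simp⟩

/-- reflection -/
def Refl (S : Set T) {Z V : T} (z : Z ⟶ V) : Prop := ∀ Y, Gt S 1 Y →
  (∀ y : V ⟶ Y, z ≫ y = 0 → y = 0) ∧ (∀ x : Z ⟶ Y, ∃ y : V ⟶ Y, z ≫ y = x)

lemma Refl.surj1 {Z V : T} {z : Z ⟶ V} (hz : Refl S z) {Y : T} (hY : Gt S 1 Y) (s : Z⟦(1:ℤ)⟧ ⟶ Y) :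
    ∃ s1 : V⟦(1:ℤ)⟧ ⟶ Y, z⟦(1:ℤ)⟧' ≫ s1 = s := by
  have hY' : Gt S 1 (Y⟦(-1:ℤ)⟧) := (hY.shift (-1) (m := 0) (by norm_num)).mono (by norm_num)
  obtain ⟨p, hp⟩ := (shiftFunctor T (1:ℤ)).map_surjective (s ≫ (shiftNegShift Y (1:ℤ)).inv)
  obtain ⟨y, hy⟩ := (hz _ hY').2 p
  refine ⟨y⟦(1:ℤ)⟧' ≫ (shiftNegShift Y (1:ℤ)).hom, ?_⟩
  rw [← Category.assoc, ← Functor.map_comp, hy, hp, Category.assoc, Iso.inv_hom_id, Category.comp_id]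

lemma refl_fiber {Z V K : T} {κ : K ⟶ Z} {z : Z ⟶ V} {v : V ⟶ K⟦(1:ℤ)⟧} (H : DT κ z v)
    (hz : Refl S z) (hV : Gt S 1 V) : Le S 1 K := by
  intro Y hY' f
  have hY := hY'.gt
  obtain ⟨E, a, b, HE⟩ := mid_ex (v ≫ f⟦(1:ℤ)⟧')
  have hE : Gt S 1 E := Gt.ext HE hY hV
  obtain ⟨zE, hzE⟩ := HE.co3 z (by rw [← Category.assoc, H.z23, zero_comp])
  obtain ⟨y, hy⟩ := (hz E hE).2 zE
  have h1 : y ≫ b = 𝟙 V := by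
    refine sub_eq_zero.1 ((hz V hV).1 _ ?_)
    rw [Preadditive.comp_sub, ← Category.assoc, hy, hzE, Category.comp_id, sub_self]
  have h2 : v ≫ f⟦(1:ℤ)⟧' = 0 := by
    rw [← Category.id_comp (v ≫ f⟦(1:ℤ)⟧'), ← h1, Category.assoc, HE.z23, comp_zero]
  obtain ⟨s, rfl⟩ := H.yo1 f h2
  obtain ⟨y', rfl⟩ := (hz Y hY).2 s
  rw [← Category.assoc, H.z12, zero_comp]

lemma corefl {X W N : T} {ξ : X ⟶ W} {n : W ⟶ N} {w : N ⟶ X⟦(1:ℤ)⟧} (H : DT ξ n w) (hX : Le S 0 X)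
    (hi : ∀ U, Le S 0 U → ∀ x : U ⟶ X, x ≫ ξ = 0 → x = 0)
    (hs : ∀ U, Le S 0 U → ∀ y : U ⟶ W, ∃ x : U ⟶ X, x ≫ ξ = y) : Gt S 0 N := by
  intro U hU t
  obtain ⟨E, a, b, HE⟩ := mid_ex (t ≫ w)
  have hE : Le S 0 E := Le.ext HE hX hU
  obtain ⟨s, hs1⟩ := HE.yo1 ξ (by rw [Category.assoc, H.z31, comp_zero])
  obtain ⟨r, hr⟩ := hs E hE s
  have h1 : a ≫ r = 𝟙 X := by
    refine sub_eq_zero.1 (hi X hX _ ?_)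
    rw [Preadditive.sub_comp, Category.assoc, hr, hs1, Category.id_comp, sub_self]
  have h2 : t ≫ w = 0 := by
    have := congrArg (fun z => z ≫ r⟦(1:ℤ)⟧') HE.z31
    simpa only [Category.assoc, ← Functor.map_comp, h1, CategoryTheory.Functor.map_id, Category.comp_id,
      zero_comp] using this
  obtain ⟨s', rfl⟩ := H.co3 t h2
  obtain ⟨r', rfl⟩ := hs U hU s'
  rw [Category.assoc, H.z12, comp_zero]

lemma im_filt1 (hS : IsSMC S) {h : T} (hh : filt S h) {K : T} (hK : Le S 1 K) (g : K ⟶ h⟦(1:ℤ)⟧) :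
    ∃ (i c : T) (ι : i ⟶ h) (π : h ⟶ c) (w : c ⟶ i⟦(1:ℤ)⟧), DT ι π w ∧ filt S i ∧ filt S c ∧
      ∃ e : K ⟶ i⟦(1:ℤ)⟧, e ≫ ι⟦(1:ℤ)⟧' = g ∧
        ∀ Y, Gt S 1 Y → ∀ y : i ⟶ Y, e ≫ y⟦(1:ℤ)⟧' = 0 → y = 0 := by
  obtain ⟨g1, hg1⟩ := (shiftFunctor T (1:ℤ)).map_surjective ((shiftNegShift K (1:ℤ)).hom ≫ g)
  obtain ⟨i, c, ι, π, w, H, fi, fc, e, he, epi⟩ := im_filt hS hh (K⟦(-1:ℤ)⟧) (hK.shift _ (by norm_num)) g1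
  refine ⟨i, c, ι, π, w, H, fi, fc, (shiftNegShift K (1:ℤ)).inv ≫ e⟦(1:ℤ)⟧', ?_, ?_⟩
  · rw [Category.assoc, ← Functor.map_comp, he, hg1, Iso.inv_hom_id_assoc]
  · intro Y hY y hy
    rw [Category.assoc, Preadditive.IsIso.comp_left_eq_zero, ← Functor.map_comp] at hy
    exact epi Y hY y (shz hy)

/-- admits a two-step truncation -/
def good0 (S : Set T) (Z : T) : Prop := ∃ (V : T) (z : Z ⟶ V), Gt S 1 V ∧ Refl S z ∧
  ∃ (C N : T) (c : C ⟶ V) (n : V ⟶ N) (w : N ⟶ C⟦(1:ℤ)⟧), DT c n w ∧ filt S C ∧ Gt S 0 N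

lemma good0.ext (hS : IsSMC S) {A Z B : T} {f : A ⟶ Z} {g : Z ⟶ B} {w : B ⟶ A⟦(1:ℤ)⟧}
    (H : DT f g w) (hA : good0 S A) (hB : good0 S B) : good0 S Z := by
  obtain ⟨VA, zA, hVA, rA, a0, NA, cA, nA, wA, HA, fa, hNA⟩ := hA
  obtain ⟨VB, zB, hVB, rB, b0, NB, cB, nB, wB, HB, fb, hNB⟩ := hB
  have hNA1 : Gt S 1 NA := hNA.mono (by norm_num)
  have hNB1 : Gt S 1 NB := hNB.mono (by norm_num)
  have le1 : ∀ {U : T}, Le S 0 U → Le S 1 (U⟦(1:ℤ)⟧) := fun h => h.s1 (by norm_num)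
  obtain ⟨K, κ, vB, HK⟩ := fib_ex zB
  have hK : Le S 1 K := refl_fiber HK rB hVB
  obtain ⟨g0, hg0⟩ := HA.co2s (κ ≫ w ≫ zA⟦(1:ℤ)⟧') (hK.z (hNA.s1 (by norm_num)) _)
  obtain ⟨i, c, ι, π, wi, Hi, fi, fc, e, he, epi⟩ := im_filt1 hS fa hK g0
  obtain ⟨V', k, k'', Hk⟩ := cone_ex (ι ≫ cA)
  obtain ⟨hV', u, v, Huv, e1, e2⟩ := O1 Hi HA Hk (fi.le hS) (fa.le hS) hVA fc.gt hNA1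
  obtain ⟨ψ, hψ⟩ := HK.yo2 (w ≫ zA⟦(1:ℤ)⟧' ≫ k⟦(1:ℤ)⟧') (by
    have h1 : κ ≫ w ≫ zA⟦(1:ℤ)⟧' ≫ k⟦(1:ℤ)⟧' = (κ ≫ w ≫ zA⟦(1:ℤ)⟧') ≫ k⟦(1:ℤ)⟧' := by
      simp only [Category.assoc]
    rw [h1, ← hg0, ← he, Category.assoc, Category.assoc, ← Functor.map_comp, ← Functor.map_comp,
      ← Category.assoc ι, Hk.z12, Functor.map_zero, comp_zero])
  obtain ⟨W, α, β, HW⟩ := mid_ex ψ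
  obtain ⟨ζ, hζ1, hζ2⟩ := tr3b H HW (zA ≫ k) zB (by rw [hψ, Functor.map_comp])
  have hW : Gt S 1 W := Gt.ext HW hV' hVB
  refine ⟨W, ζ, hW, ?_, ?_⟩
  · intro Y hY
    constructor
    · intro y hy
      have h1 : k ≫ α ≫ y = 0 := (rA Y hY).1 _ (by
        have : zA ≫ k ≫ α ≫ y = ((zA ≫ k) ≫ α) ≫ y := by simp only [Category.assoc]
        rw [this, ← hζ1, Category.assoc, hy, comp_zero])
      have h2 : α ≫ y = 0 := by
        obtain ⟨s, hs⟩ := Hk.yo3 _ h1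
        rw [← hs, (le1 (fi.le hS)).z hY s, comp_zero]
      obtain ⟨y', rfl⟩ := HW.yo2 y h2
      obtain ⟨s, hs⟩ := H.yo3 (zB ≫ y') (by rw [← Category.assoc, hζ2, Category.assoc, hy])
      obtain ⟨s1, rfl⟩ := rA.surj1 hY s
      obtain ⟨s2, rfl⟩ := Hk.yo2s s1 ((le1 (fi.le hS)).z hY _)
      have h3 : y' = ψ ≫ s2 := by
        refine sub_eq_zero.1 ((rB Y hY).1 _ ?_)
        rw [Preadditive.comp_sub, ← hs, ← Category.assoc zB, hψ]
        simp
      rw [h3, ← Category.assoc, HW.z23, zero_comp]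
    · intro x
      obtain ⟨v1, hv1⟩ := (rA Y hY).2 (f ≫ x)
      have h1 : (ι ≫ cA) ≫ v1 = 0 := epi Y hY _ (by
        rw [Functor.map_comp, Functor.map_comp, Category.assoc, ← Category.assoc e, he, ← Category.assoc g0,
          hg0]
        simp only [Category.assoc]
        rw [← Functor.map_comp, hv1, Functor.map_comp, ← Category.assoc w, H.z31, zero_comp, comp_zero])
      obtain ⟨v2, rfl⟩ := Hk.yo2 v1 h1
      have h2 : ψ ≫ v2⟦(1:ℤ)⟧' = 0 := by
        obtain ⟨t, ht⟩ := HK.yo3 (ψ ≫ v2⟦(1:ℤ)⟧') (by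
          rw [← Category.assoc, hψ]
          simp only [Category.assoc]
          rw [← Functor.map_comp, ← Functor.map_comp, hv1, Functor.map_comp, ← Category.assoc, H.z31, zero_comp])
        rw [← ht, (hK.s1 rfl).z (hY.s1 rfl) t, comp_zero]
      obtain ⟨v3, rfl⟩ := HW.yo1 v2 h2
      obtain ⟨b, hb⟩ := H.yo2 (x - ζ ≫ v3) (by
        rw [Preadditive.comp_sub, ← Category.assoc f, hζ1, ← hv1]; simp)
      obtain ⟨b', rfl⟩ := (rB Y hY).2 b
      refine ⟨v3 + β ≫ b', ?_⟩
      rw [Preadditive.comp_add, ← Category.assoc ζ β, ← hζ2, Category.assoc, hb]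
      abel
  · obtain ⟨kk, j, κ', π', w', Hkk, fkk, fj, γ, hγ, mono⟩ :=
      ker_filt hS fb (NA⟦(1:ℤ)⟧) (hNA.s1 (by norm_num)) (cB ≫ ψ ≫ v⟦(1:ℤ)⟧')
    obtain ⟨χ, hχ⟩ := Huv.co2s (κ' ≫ cB ≫ ψ) (by
      simp only [Category.assoc]
      rw [← hγ, ← Category.assoc, Hkk.z12, zero_comp])
    obtain ⟨X, x1, x2, HX⟩ := mid_ex χ
    have fX : filt S X := .ext _ _ _ HX fc fkk
    obtain ⟨ξ, hξ1, hξ2⟩ := tr3b HX HW u (κ' ≫ cB) (by rw [hχ, Category.assoc])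
    obtain ⟨N, n, wN, HN⟩ := cone_ex ξ
    refine ⟨X, N, ξ, n, wN, HN, fX, corefl HN (fX.le hS) ?_ ?_⟩
    · intro U hU x hx
      have h1 : ((x ≫ x2) ≫ κ') ≫ cB = 0 := by
        simp only [Category.assoc]
        rw [hξ2, ← Category.assoc, hx, zero_comp]
      have h2 := HB.coinj (fun t => (le1 hU).z hNB1 t) _ h1
      have h3 := Hkk.coinj (fun t => (le1 hU).z fj.gt t) _ h2
      obtain ⟨x', rfl⟩ := HX.co2 x h3
      have h4 : (x' ≫ u) ≫ α = 0 := by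
        rw [Category.assoc, ← hξ1, ← Category.assoc, hx]
      have h5 := HW.coinj (fun t => (le1 hU).z hVB t) _ h4
      have h6 := Huv.coinj (fun t => (le1 hU).z hNA1 t) _ h5
      rw [h6, zero_comp]
    · intro U hU y
      obtain ⟨y1, hy1⟩ := HB.co2 (y ≫ β) (hU.z hNB _)
      have h1 : y1 ≫ π' = 0 := mono U hU _ (by
        rw [Category.assoc, hγ, ← Category.assoc, hy1, Category.assoc, ← Category.assoc β, HW.z23,
          zero_comp, comp_zero])
      obtain ⟨y2, rfl⟩ := Hkk.co2 y1 h1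
      have h2 : y2 ≫ χ = 0 := by
        obtain ⟨s, hs⟩ := Huv.co1 (y2 ≫ χ) (by
          rw [Category.assoc, hχ]
          have : y2 ≫ κ' ≫ cB ≫ ψ = ((y2 ≫ κ') ≫ cB) ≫ ψ := by simp only [Category.assoc]
          rw [this, hy1, Category.assoc, HW.z23, comp_zero])
        rw [← hs, hU.z hNA s, zero_comp]
      obtain ⟨y3, rfl⟩ := HX.co3 y2 h2
      obtain ⟨y4, hy4⟩ := HW.co2 (y - y3 ≫ ξ) (by
        rw [Preadditive.sub_comp, Category.assoc, ← hξ2, ← hy1]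
        simp)
      obtain ⟨y5, rfl⟩ := Huv.co2 y4 (hU.z hNA _)
      refine ⟨y3 + y5 ≫ x1, ?_⟩
      rw [Preadditive.add_comp, Category.assoc y5, hξ1, ← Category.assoc, hy4]
      abel

end

section
variable {S : Set T}
open ZeroObject

lemma good0.of_le {Z : T} (h : Le S 1 Z) : good0 S Z :=
  ⟨0, 0, Gt.zero (isZero_zero T), fun Y hY => ⟨fun y _ => (isZero_zero T).eq_of_src _ _,
    fun x => ⟨0, by rw [h.z hY x, comp_zero]⟩⟩, 0, 0, _, _, _, dt_id_l 0, .zero (isZero_zero T),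
    Gt.zero (isZero_zero T)⟩

lemma refl_id (Z : T) : Refl S (𝟙 Z) := fun Y _ => ⟨fun y hy => by simpa using hy,
  fun x => ⟨x, by simp⟩⟩

lemma good0.of_gt {Z : T} (h : Gt S 0 Z) : good0 S Z :=
  ⟨Z, 𝟙 Z, h.mono (by norm_num), refl_id Z, 0, Z, _, _, _, dt_id_l Z, .zero (isZero_zero T), h⟩

lemma good0.of_filt {Z : T} (h : filt S Z) : good0 S Z :=
  ⟨Z, 𝟙 Z, h.gt, refl_id Z, Z, 0, _, _, _, dt_id_r Z, h, Gt.zero (isZero_zero T)⟩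

lemma good0.iso (hS : IsSMC S) {X Y : T} (h : good0 S X) (e : X ≅ Y) : good0 S Y :=
  good0.ext hS (f := e.hom) (g := (0 : Y ⟶ (0 : T))) (w := 0) (DT.zeroR (isZero_zero T)) h
    (good0.of_le (Le.zero (isZero_zero T)))

lemma Le.retract {n : ℤ} {X Y : T} (i : X ⟶ Y) (r : Y ⟶ X) (h : i ≫ r = 𝟙 X) (hY : Le S n Y) :
    Le S n X := fun W hW f => by
  rw [← Category.id_comp f, ← h, Category.assoc, hY W hW (r ≫ f), comp_zero]

lemma Gt.retract {n : ℤ} {X Y : T} (i : X ⟶ Y) (r : Y ⟶ X) (h : i ≫ r = 𝟙 X) (hY : Gt S n Y) :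
    Gt S n X := fun W hW f => by
  rw [← Category.comp_id f, ← h, ← Category.assoc, hY W hW (f ≫ i), zero_comp]

lemma thick_le (hS : IsSMC S) {X : T} (h : thick S X) : ∃ n, Le S n X := by
  induction h with
  | of h => exact ⟨0, mem_le hS h⟩
  | zero h => exact ⟨0, Le.zero h⟩
  | shift hX k ih => obtain ⟨n, hn⟩ := ih; exact ⟨n + k, hn.shift k rfl⟩
  | ext f g h hT _ _ hA hB =>
    obtain ⟨a, ha⟩ := hA
    obtain ⟨b, hb⟩ := hB
    exact ⟨min a b, Le.ext hT (ha.mono (min_le_left _ _)) (hb.mono (min_le_right _ _))⟩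
  | smd i r hir _ ih => obtain ⟨n, hn⟩ := ih; exact ⟨n, hn.retract i r hir⟩

lemma thick_gt {X : T} (h : thick S X) : ∃ n, Gt S n X := by
  induction h with
  | of h => exact ⟨1, mem_gt h⟩
  | zero h => exact ⟨0, Gt.zero h⟩
  | shift hX k ih => obtain ⟨n, hn⟩ := ih; exact ⟨n + k, hn.shift k rfl⟩
  | ext f g h hT _ _ hA hB =>
    obtain ⟨a, ha⟩ := hA
    obtain ⟨b, hb⟩ := hB
    exact ⟨max a b, Gt.ext hT (ha.mono (le_max_left _ _)) (hb.mono (le_max_right _ _))⟩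
  | smd i r hir _ ih => obtain ⟨n, hn⟩ := ih; exact ⟨n, hn.retract i r hir⟩

lemma good_retract (hS : IsSMC S) {Z : T} (hZ : ∀ n : ℤ, good0 S (Z⟦n⟧)) (m : ℕ) :
    ∀ (X : T) (i : X ⟶ Z) (r : Z ⟶ X), i ≫ r = 𝟙 X → ∀ n : ℤ, Le S (1 - n - m) Z →
      good0 S (X⟦n⟧) := by
  induction m with
  | zero =>
    intro X i r hir n h
    exact good0.of_le ((h.retract i r hir).shift n (by push_cast; ring))
  | succ m ih =>
    intro X i r hir n h
    obtain ⟨F, φ, δ, H⟩ := fib_ex r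
    have hδ : δ = 0 := by
      rw [← Category.id_comp δ, ← hir, Category.assoc, H.z23, comp_zero]
    obtain ⟨s, hs⟩ := H.yo1 (𝟙 F) (by rw [hδ, zero_comp])
    have hF := ih F φ s hs (1 + n) (h.mono (by push_cast; linarith))
    obtain ⟨h', H'⟩ := H.rot.shift n
    exact good0.ext hS H' (hZ n) (hF.iso hS ((shiftFunctorAdd T 1 n).app F))

lemma thick_good (hS : IsSMC S) {X : T} (h : thick S X) : ∀ n : ℤ, good0 S (X⟦n⟧) := by
  induction h with
  | of h =>
    intro n
    rcases lt_trichotomy n 0 with hn | rfl | hn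
    · exact good0.of_gt (((mem_gt h).shift n rfl).mono (by omega))
    · exact (good0.of_filt (filt.of h)).iso hS ((shiftFunctorZero T ℤ).app _).symm
    · exact good0.of_le (((mem_le hS h).shift n rfl).mono (by omega))
  | zero h => exact fun n => good0.of_le ((Le.zero (S := S) (n := 1 - n) h).shift n (by ring))
  | shift hX k ih => exact fun n => (ih (k + n)).iso hS ((shiftFunctorAdd T k n).app _)
  | ext f g h hT _ _ hA hB =>
    intro n
    obtain ⟨h', H'⟩ := DT.shift hT n
    exact good0.ext hS H' (hA n) (hB n)
  | @smd X Y i r hir hY ih =>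
    intro n
    obtain ⟨k, hk⟩ := thick_le hS hY
    exact good_retract hS ih (1 - n - k).toNat X i r hir n (hk.mono (by
      have := Int.self_le_toNat (1 - n - k); omega))

lemma all_good (hS : IsSMC S) (Z : T) : good0 S Z :=
  (thick_good hS (hS.generates Z) 0).iso hS ((shiftFunctorZero T ℤ).app _)

lemma trunc (hS : IsSMC S) (n : ℤ) (Z : T) :
    ∃ (K V : T) (κ : K ⟶ Z) (z : Z ⟶ V) (w : V ⟶ K⟦(1:ℤ)⟧), DT κ z w ∧ Le S n K ∧ Gt S n V := by
  obtain ⟨V, z, hV, hz, -⟩ := thick_good hS (hS.generates Z) (1 - n)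
  obtain ⟨K, κ, w, H⟩ := fib_ex z
  have hK := refl_fiber H hz hV
  obtain ⟨w', H'⟩ := H.shift (n - 1)
  let e : (Z⟦1 - n⟧)⟦n - 1⟧ ≅ Z := (shiftFunctorCompIsoId T (1 - n) (n - 1) (by ring)).app Z
  exact ⟨_, _, κ⟦n-1⟧' ≫ e.hom, e.inv ≫ z⟦n-1⟧', w',
    H'.iso (Iso.refl _) e (Iso.refl _) (by simp) (by simp) (by simp),
    hK.shift _ (by ring), hV.shift _ (by ring)⟩

lemma heart_filt (hS : IsSMC S) {X : T} (h1 : Le S 0 X) (h2 : Gt S 1 X) : filt S X := by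
  obtain ⟨V, z, hV, hz, C, N, c, n, w, Hc, fC, hN⟩ := all_good hS X
  obtain ⟨K, κ, w', H⟩ := fib_ex z
  have hK := refl_fiber H hz hV
  have hK' : Gt S 1 K := Gt.fib H h2 hV (by norm_num)
  have := H.isoR (isZero_of_id (hK.z hK' _))
  have hV0 : Le S 0 V := h1.iso (asIso z)
  have hN' : Le S 0 N := Le.cone Hc (fC.le hS) hV0 (by norm_num)
  have := Hc.isoL (isZero_of_id (hN'.z hN _))
  exact (fC.iso (asIso c)).iso (asIso z).symm

lemma mem_leS {X : T} : X ∈ leS S ↔ Le S 0 X := by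
  constructor
  · rintro h Y ⟨s, hs, m, hm, ⟨e⟩⟩ f
    have h1 := h (-m) (by omega) s hs ((f ≫ e.hom)⟦-m⟧' ≫ (shiftShiftNeg s m).hom)
    rw [Preadditive.IsIso.comp_right_eq_zero] at h1
    have h2 : f ≫ e.hom = 0 := (shiftFunctor T (-m)).map_injective (by rw [h1, Functor.map_zero])
    rwa [Preadditive.IsIso.comp_right_eq_zero] at h2
  · intro h n hn s hs f
    exact h.shift n (m := n) (by ring) s ⟨s, hs, 0, hn, ⟨((shiftFunctorZero T ℤ).app s).symm⟩⟩ f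

lemma geChain_gt {l : ℕ} : ∀ {X : T}, X ∈ geChainS S l → Gt S 1 X := by
  induction l with
  | zero => intro X h; exact filt.gt h
  | succ l ih =>
    rintro X ⟨A, B, f, g, h, H, hA, ⟨Y, hY, rfl⟩⟩
    exact Gt.ext H (ih hA) (((filt.gt hY).shift _ rfl).mono (by omega))

lemma gt_geChain (hS : IsSMC S) {l : ℕ} : ∀ {X : T}, Gt S 1 X → Le S (-l) X → X ∈ geChainS S l := by
  induction l with
  | zero => intro X h h'; exact heart_filt hS (by simpa using h') h
  | succ l ih =>
    intro X h h'
    obtain ⟨U, V, κ, z, w, H, hU, hV⟩ := trunc hS (-l) X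
    have hU1 : Gt S 1 U := Gt.fib H h hV (by omega)
    have hV1 : Le S (-(l+1:ℕ)) V := Le.cone H hU h' (by push_cast; omega)
    let e : (V⟦(l + 1 : ℤ)⟧)⟦-(l + 1 : ℤ)⟧ ≅ V := shiftShiftNeg V (l + 1 : ℤ)
    refine ⟨U, _, κ, z ≫ e.inv, e.hom ≫ w,
      H.iso (Iso.refl _) (Iso.refl _) e.symm (by simp) (by simp) (by simp), ih hU1 hU,
      ⟨V⟦(l + 1 : ℤ)⟧, ?_, rfl⟩⟩
    exact heart_filt hS (hV1.shift _ (by push_cast; ring)) (hV.shift _ (by ring))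

lemma leChain_le (hS : IsSMC S) {l : ℕ} : ∀ {X : T}, X ∈ leChainS S l → Le S 0 X := by
  induction l with
  | zero => intro X h; exact filt.le hS h
  | succ l ih =>
    rintro X ⟨A, B, f, g, h, H, ⟨Y, hY, rfl⟩, hB⟩
    exact Le.ext H (((filt.le hS hY).shift _ rfl).mono (by omega)) (ih hB)

lemma le_leChain (hS : IsSMC S) {l : ℕ} : ∀ {X : T}, Le S 0 X → Gt S (l + 1) X → X ∈ leChainS S l := by
  induction l with
  | zero => intro X h h'; exact heart_filt hS h (by simpa using h')
  | succ l ih =>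
    intro X h h'
    obtain ⟨U, V, κ, z, w, H, hU, hV⟩ := trunc hS (l + 1) X
    have hU1 : Gt S (l + 1 + 1) U := Gt.fib H (by push_cast at h'; exact h') hV (by omega)
    have hV1 : Le S 0 V := Le.cone H hU h (by omega)
    let e : (U⟦-(l + 1 : ℤ)⟧)⟦(l + 1 : ℤ)⟧ ≅ U := shiftNegShift U (l + 1 : ℤ)
    refine ⟨_, V, e.hom ≫ κ, z, w ≫ e.inv⟦(1:ℤ)⟧',
      H.iso e.symm (Iso.refl _) (Iso.refl _) (by simp) (by simp) (by simp),
      ⟨U⟦-(l + 1 : ℤ)⟧, ?_, rfl⟩, ih hV1 hV⟩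
    exact heart_filt hS (hU.shift _ (by ring)) (hU1.shift _ (by ring))

lemma mem_geS (hS : IsSMC S) {X : T} : X ∈ geS S ↔ Gt S 1 X := by
  constructor
  · intro h
    obtain ⟨l, hl⟩ := Set.mem_iUnion.1 h
    exact geChain_gt hl
  · intro h
    obtain ⟨n, hn⟩ := thick_le hS (hS.generates X)
    exact Set.mem_iUnion.2 ⟨n.natAbs, gt_geChain hS h (hn.mono (by omega))⟩

end

/-- for a simple-minded collection `S` of `T`, the pair
`(T^{S,≤0}, T^{S,≥0})` is a `t`-structure whose heart is the extension closure of `S`,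
and `T^{S,≤0} = ⋃_{l ≥ 0} Σ^l Filt(S) ∗ ⋯ ∗ Filt(S)`. -/
theorem stmt1 (S : Set T) (hS : IsSMC S) :
    IsTStr (leS S) (geS S) ∧
    heart (leS S) (geS S) = {X | filt S X} ∧
    leS S = ⋃ l, leChainS S l := by
  refine ⟨⟨?_, ?_, ?_, ?_⟩, ?_, ?_⟩
  · intro X hX
    rw [mem_leS] at hX ⊢
    exact (hX.s1 (m := 1) (by norm_num)).mono (by norm_num)
  · intro X hX
    rw [mem_geS hS] at hX ⊢
    exact (hX.shift (-1) (m := 0) (by norm_num)).mono (by norm_num)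
  · intro X hX Y hY f
    rw [mem_leS] at hX
    rw [mem_geS hS] at hY
    exact hX.z (hY.shift (-1) (by norm_num)) f
  · intro Z
    obtain ⟨K, V, κ, z, w, H, hK, hV⟩ := trunc hS 0 Z
    let e : (V⟦(1 : ℤ)⟧)⟦(-1 : ℤ)⟧ ≅ V := shiftShiftNeg V (1 : ℤ)
    exact ⟨K, _, κ, z ≫ e.inv, e.hom ≫ w,
      H.iso (Iso.refl _) (Iso.refl _) e.symm (by simp) (by simp) (by simp), mem_leS.2 hK,
      ⟨V⟦(1 : ℤ)⟧, (mem_geS hS).2 (hV.s1 (by norm_num)), rfl⟩⟩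
  · ext X
    constructor
    · rintro ⟨h1, h2⟩
      exact heart_filt hS (mem_leS.1 h1) ((mem_geS hS).1 h2)
    · intro h
      exact ⟨mem_leS.2 (filt.le hS h), (mem_geS hS).2 (filt.gt h)⟩
  · ext X
    rw [mem_leS]
    constructor
    · intro h
      obtain ⟨n, hn⟩ := thick_gt (hS.generates X)
      exact Set.mem_iUnion.2 ⟨n.natAbs, le_leChain hS h (hn.mono (by omega))⟩
    · intro h
      obtain ⟨l, hl⟩ := Set.mem_iUnion.1 h
      exact leChain_le hS hl

end STPaper
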